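/- arXiv:nlin/0312048 — 3 statements merged into one kernel-verified Lean document; each statement's English description precedes it below -/
import Mathlib

section
/- Let α ∈ ℝ and let u: ℝ × ℝⁿ → ℝⁿ be a smooth solution of the EPDiff equation with momentum m_i = u_i − α²Δu_i. Then the Lagrangian acceleration a_i := ∂_t u_i + Σ_j u_j ∂_j u_i satisfies, for each i = 1,…,n and at every point, (1 − α²Δ) a_i = −α² Σ_k ∂_k( Σ_j ( ∂_j u_i ∂_k u_j + ∂_j u_i ∂_j u_k − ∂_i u_j ∂_k u_j ) − (∂_k u_i)(div u) + (1/2) δ_{ik} Σ_{j,l} (∂_l u_j)² ) − u_i (div u) − (1/2) ∂_i Σ_j u_j². In particular, the right-hand side involves at most second spatial derivatives of u, so the n-dimensional EPDiff equation in Lagrangian form has no derivative loss. -/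
/-- Partial derivative ∂ⱼf of a scalar function on ℝⁿ. -/
noncomputable def pd {n : ℕ} (f : (Fin n → ℝ) → ℝ) (j : Fin n) : (Fin n → ℝ) → ℝ :=
  fun x => fderiv ℝ f x (Pi.single j 1)

/-- Laplacian Δf = Σₖ ∂ₖ²f of a scalar function on ℝⁿ. -/
noncomputable def lap {n : ℕ} (f : (Fin n → ℝ) → ℝ) : (Fin n → ℝ) → ℝ :=
  fun x => ∑ k, pd (pd f k) k x

open Finset

noncomputable def dD {E : Type*} [NormedAddCommGroup E] [NormedSpace ℝ E] (v : E) (f : E → ℝ) : E → ℝ :=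
  fun p => fderiv ℝ f p v

section
variable {E : Type*} [NormedAddCommGroup E] [NormedSpace ℝ E]

theorem dD_smooth (v : E) {f : E → ℝ} (hf : ContDiff ℝ (⊤ : ℕ∞) f) : ContDiff ℝ (⊤ : ℕ∞) (dD v f) := by
  unfold dD
  exact (hf.fderiv_right (m := (⊤ : ℕ∞)) (by simp)).clm_apply contDiff_const

theorem smooth_diff {f : E → ℝ} (hf : ContDiff ℝ (⊤ : ℕ∞) f) : Differentiable ℝ f :=
  hf.differentiable (by simp)

theorem dD_comm (v w : E) {f : E → ℝ} (hf : ContDiff ℝ (⊤ : ℕ∞) f) : dD v (dD w f) = dD w (dD v f) := by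
  have hd : Differentiable ℝ (fderiv ℝ f) :=
    (hf.fderiv_right (m := (⊤ : ℕ∞)) (by simp)).differentiable (by simp)
  have key : ∀ v w p, dD v (dD w f) p = fderiv ℝ (fderiv ℝ f) p v w := by
    intro v w p
    unfold dD
    rw [fderiv_clm_apply (hd p) (differentiableAt_const _)]
    simp
  funext p
  rw [key, key]
  have := (hf.contDiffAt (x := p)).isSymmSndFDerivAt (by simp only [minSmoothness_of_isRCLikeNormedField]; exact WithTop.coe_le_coe.2 (le_top (a := (2 : ℕ∞))))
  exact this v w

theorem dD_add (v : E) {f g : E → ℝ} (hf : ContDiff ℝ (⊤ : ℕ∞) f) (hg : ContDiff ℝ (⊤ : ℕ∞) g) :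
    dD v (fun p => f p + g p) = fun p => dD v f p + dD v g p := by
  funext p; unfold dD
  rw [fderiv_fun_add (smooth_diff hf p) (smooth_diff hg p)]; rfl

theorem dD_sub (v : E) {f g : E → ℝ} (hf : ContDiff ℝ (⊤ : ℕ∞) f) (hg : ContDiff ℝ (⊤ : ℕ∞) g) :
    dD v (fun p => f p - g p) = fun p => dD v f p - dD v g p := by
  funext p; unfold dD
  rw [fderiv_fun_sub (smooth_diff hf p) (smooth_diff hg p)]; rfl

theorem dD_mul (v : E) {f g : E → ℝ} (hf : ContDiff ℝ (⊤ : ℕ∞) f) (hg : ContDiff ℝ (⊤ : ℕ∞) g) :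
    dD v (fun p => f p * g p) = fun p => f p * dD v g p + dD v f p * g p := by
  funext p; unfold dD
  rw [fderiv_fun_mul (smooth_diff hf p) (smooth_diff hg p)]; simp [mul_comm]

theorem dD_cmul (v : E) (c : ℝ) {g : E → ℝ} (hg : ContDiff ℝ (⊤ : ℕ∞) g) :
    dD v (fun p => c * g p) = fun p => c * dD v g p := by
  funext p; unfold dD
  rw [fderiv_const_mul (smooth_diff hg p)]; simp

theorem dD_sum (v : E) {ι : Type*} (s : Finset ι) {f : ι → E → ℝ} (hf : ∀ i, ContDiff ℝ (⊤ : ℕ∞) (f i)) :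
    dD v (fun p => ∑ i ∈ s, f i p) = fun p => ∑ i ∈ s, dD v (f i) p := by
  funext p; unfold dD
  rw [fderiv_fun_sum (fun i _ => smooth_diff (hf i) p)]; simp

end

theorem pd_slice {n : ℕ} {f : ℝ × (Fin n → ℝ) → ℝ} (hf : ContDiff ℝ (⊤ : ℕ∞) f) (t : ℝ) (j : Fin n) :
    pd (fun y => f (t, y)) j = fun x => dD ((0 : ℝ), (Pi.single j 1 : Fin n → ℝ)) f (t, x) := by
  funext x
  unfold pd dD
  have h1 : HasFDerivAt (fun y : Fin n → ℝ => (t, y)) (ContinuousLinearMap.inr ℝ ℝ (Fin n → ℝ)) x :=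
    hasFDerivAt_prodMk_right t x
  have h2 := (smooth_diff hf (t, x)).hasFDerivAt.comp x h1
  have h3 := h2.fderiv
  simp only [Function.comp_def] at h3
  rw [h3]; simp

theorem deriv_slice {n : ℕ} {f : ℝ × (Fin n → ℝ) → ℝ} (hf : ContDiff ℝ (⊤ : ℕ∞) f) (t : ℝ) (x : Fin n → ℝ) :
    deriv (fun s => f (s, x)) t = dD ((1 : ℝ), (0 : Fin n → ℝ)) f (t, x) := by
  unfold dD
  have h1 : HasFDerivAt (fun s : ℝ => (s, x)) (ContinuousLinearMap.inl ℝ ℝ (Fin n → ℝ)) t :=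
    hasFDerivAt_prodMk_left t x
  have h2 := (smooth_diff hf (t, x)).hasFDerivAt.comp t h1
  have h3 := h2.hasDerivAt.deriv
  simp only [Function.comp_def] at h3
  rw [h3]; simp

theorem epdiff_alg {n : ℕ} (al : ℝ) (w : Fin n → ℝ) (d : Fin n → Fin n → ℝ)
    (h : Fin n → Fin n → Fin n → ℝ) (q : Fin n → Fin n → Fin n → ℝ)
    (hs : ∀ i j k, h i j k = h i k j) (i : Fin n) (T : ℝ) (S : Fin n → ℝ)
    (hE : (T - al ^ 2 * ∑ k, S k) + ∑ j, w j * (d i j - al ^ 2 * ∑ k, q i j k)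
      + ∑ j, (w j - al ^ 2 * ∑ k, h j k k) * d j i
      + (w i - al ^ 2 * ∑ k, h i k k) * ∑ j, d j j = 0) :
    (T + ∑ j, w j * d i j) - al ^ 2 * ∑ k, (S k + ∑ j, ((w j * q i j k + d j k * h i j k) +
        (d j k * h i j k + h j k k * d i j)))
      = -al ^ 2 * ∑ k, ((∑ j, (((d i j * h j k k + h i j k * d j k)
            + (d i j * h k j k + h i j k * d k j))
            - (d j i * h j k k + h j i k * d j k)))
          - (d i k * (∑ j, h j j k) + h i k k * ∑ j, d j j)
          + (1 / 2 * (if i = k then (1 : ℝ) else 0)) * ∑ j, ∑ l, (d j l * h j l k + h j l k * d j l))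
        - w i * (∑ j, d j j) - (1 / 2) * ∑ j, (w j * d j i + d j i * w j) := by
  have e1 : ∑ k, (1 / 2 * (if i = k then (1 : ℝ) else 0)) *
      (∑ j, ∑ l, (d j l * h j l k + h j l k * d j l)) = ∑ k, ∑ j, h j i k * d j k := by
    rw [Finset.sum_eq_single i]
    · simp only [if_true, mul_one, mul_sum]
      rw [Finset.sum_comm]
      refine sum_congr rfl fun k _ => sum_congr rfl fun j _ => ?_
      rw [hs j i k]; ring
    · intro b _ hb; simp [Ne.symm hb]
    · simp
  have e2 : ∑ k, ∑ j, d i j * h k j k = ∑ k, d i k * ∑ j, h j j k := by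
    rw [Finset.sum_comm]
    refine sum_congr rfl fun k _ => ?_
    rw [mul_sum]
    refine sum_congr rfl fun j _ => ?_
    rw [hs j k j]
  have e3 : ∑ k, ∑ j, h i j k * d k j = ∑ k, ∑ j, h i j k * d j k := by
    rw [Finset.sum_comm]
    refine sum_congr rfl fun k _ => sum_congr rfl fun j _ => ?_
    rw [hs i k j]
  have e4 : ∑ j, w j * (d i j - al ^ 2 * ∑ k, q i j k) =
      ∑ j, w j * d i j - al ^ 2 * ∑ k, ∑ j, w j * q i j k := by
    rw [Finset.sum_comm (f := fun k j => w j * q i j k), mul_sum, ← sum_sub_distrib]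
    refine sum_congr rfl fun k _ => ?_
    rw [← mul_sum]; ring
  have e5 : ∑ j, (w j - al ^ 2 * ∑ k, h j k k) * d j i =
      ∑ j, w j * d j i - al ^ 2 * ∑ k, ∑ j, d j i * h j k k := by
    rw [Finset.sum_comm (f := fun k j => d j i * h j k k), mul_sum, ← sum_sub_distrib]
    refine sum_congr rfl fun k _ => ?_
    rw [← mul_sum]; ring
  rw [e4, e5] at hE
  simp only [sum_add_distrib] at e1
  simp only [sum_add_distrib, sum_sub_distrib, e1, e2, e3]
  rw [← Finset.sum_mul]
  have c1 : ∑ k, ∑ j, d j k * h i j k = ∑ k, ∑ j, h i j k * d j k := by simp only [mul_comm]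
  have c2 : ∑ k, ∑ j, h j k k * d i j = ∑ k, ∑ j, d i j * h j k k := by simp only [mul_comm]
  have c3 : ∑ j, d j i * w j = ∑ j, w j * d j i := by simp only [mul_comm]
  rw [c1, c2, c3]
  linear_combination hE

/-- for a smooth solution of the n-dimensional EPDiff equation with momentum
m = u − α²Δu, the Lagrangian acceleration a = ∂ₜu + u·∇u satisfies
(1 − α²Δ)aᵢ = −α²Σₖ∂ₖ( Σⱼ(∂ⱼuᵢ∂ₖuⱼ + ∂ⱼuᵢ∂ⱼuₖ − ∂ᵢuⱼ∂ₖuⱼ) − ∂ₖuᵢ div u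
                + ½δᵢₖ Σⱼₗ(∂ₗuⱼ)² ) − uᵢ div u − ½∂ᵢ|u|²,
so EPDiff in Lagrangian form has no derivative loss. -/
theorem epdiff_no_derivative_loss (n : ℕ) (α : ℝ) (u : ℝ → (Fin n → ℝ) → Fin n → ℝ)
    (hu : ContDiff ℝ (⊤ : ℕ∞) (fun p : ℝ × (Fin n → ℝ) => u p.1 p.2))
    (m : ℝ → (Fin n → ℝ) → Fin n → ℝ)
    (hm : ∀ t x i, m t x i = u t x i - α ^ 2 * lap (fun y => u t y i) x)
    (hEP : ∀ t x (i : Fin n),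
      deriv (fun s => m s x i) t
        + ∑ j, u t x j * pd (fun y => m t y i) j x
        + ∑ j, m t x j * pd (fun y => u t y j) i x
        + m t x i * ∑ j, pd (fun y => u t y j) j x = 0)
    (a : ℝ → (Fin n → ℝ) → Fin n → ℝ)
    (ha : ∀ t x i, a t x i
      = deriv (fun s => u s x i) t + ∑ j, u t x j * pd (fun y => u t y i) j x) :
    ∀ t x (i : Fin n),
      a t x i - α ^ 2 * lap (fun y => a t y i) x
        = -α ^ 2 * ∑ k, pd (fun y =>
              (∑ j, (pd (fun z => u t z i) j y * pd (fun z => u t z j) k y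
                  + pd (fun z => u t z i) j y * pd (fun z => u t z k) j y
                  - pd (fun z => u t z j) i y * pd (fun z => u t z j) k y))
                - pd (fun z => u t z i) k y * (∑ j, pd (fun z => u t z j) j y)
                + (1 / 2) * (if i = k then (1 : ℝ) else 0)
                    * ∑ j, ∑ l, (pd (fun z => u t z j) l y) ^ 2) k x
          - u t x i * (∑ j, pd (fun y => u t y j) j x)
          - (1 / 2) * pd (fun y => ∑ j, (u t y j) ^ 2) i x := by
  have hU : ∀ i, ContDiff ℝ (⊤ : ℕ∞) (fun p : ℝ × (Fin n → ℝ) => u p.1 p.2 i) :=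
    fun i => (contDiff_pi.1 hu) i
  obtain ⟨U, hUd⟩ : ∃ U : Fin n → ℝ × (Fin n → ℝ) → ℝ, U = fun i p => u p.1 p.2 i := ⟨_, rfl⟩
  have hUs : ∀ i, ContDiff ℝ (⊤ : ℕ∞) (U i) := by rw [hUd]; exact hU
  have hut : ∀ t x i, u t x i = U i (t, x) := by rw [hUd]; intros; rfl
  obtain ⟨e, he⟩ : ∃ e : Fin n → ℝ × (Fin n → ℝ),
    e = fun j => ((0 : ℝ), (Pi.single j 1 : Fin n → ℝ)) := ⟨_, rfl⟩
  obtain ⟨τ, hτ⟩ : ∃ τ : ℝ × (Fin n → ℝ), τ = ((1 : ℝ), (0 : Fin n → ℝ)) := ⟨_, rfl⟩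
  have hpd : ∀ {f : ℝ × (Fin n → ℝ) → ℝ}, ContDiff ℝ (⊤ : ℕ∞) f → ∀ t j,
      pd (fun y => f (t, y)) j = fun x => dD (e j) f (t, x) := by
    intro f hf t j; rw [he]; exact pd_slice hf t j
  have hdt : ∀ {f : ℝ × (Fin n → ℝ) → ℝ}, ContDiff ℝ (⊤ : ℕ∞) f → ∀ t x,
      deriv (fun s => f (s, x)) t = dD τ f (t, x) := by
    intro f hf t x; rw [hτ]; exact deriv_slice hf t x
  clear hU hUd
  have hD : ∀ v i, ContDiff ℝ (⊤ : ℕ∞) (dD v (U i)) := fun v i => dD_smooth v (hUs i)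
  have hDD : ∀ v w i, ContDiff ℝ (⊤ : ℕ∞) (dD v (dD w (U i))) := fun v w i => dD_smooth v (hD w i)
  have hlap : ∀ {f : ℝ × (Fin n → ℝ) → ℝ}, ContDiff ℝ (⊤ : ℕ∞) f → ∀ t x,
      lap (fun y => f (t, y)) x = ∑ k, dD (e k) (dD (e k) f) (t, x) := by
    intro f hf t x
    unfold lap
    refine sum_congr rfl fun k _ => ?_
    rw [hpd hf, hpd (dD_smooth _ hf)]
  simp only [hut, hpd (hUs _), hlap (hUs _), hdt (hUs _)] at hm ha hEP ⊢
  simp only [hm] at hEP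
  simp only [ha]
  intro t x i
  have hE := hEP t x i
  have sL : ∀ i, ContDiff ℝ (⊤ : ℕ∞) (fun p => ∑ k, dD (e k) (dD (e k) (U i)) p) :=
    fun i => ContDiff.sum fun k _ => hDD _ _ _
  have sM : ∀ i, ContDiff ℝ (⊤ : ℕ∞)
      (fun p => U i p - α ^ 2 * ∑ k, dD (e k) (dD (e k) (U i)) p) :=
    fun i => (hUs i).sub (contDiff_const.mul (sL i))
  have dM : ∀ v i, dD v (fun p => U i p - α ^ 2 * ∑ k, dD (e k) (dD (e k) (U i)) p)
      = fun p => dD v (U i) p - α ^ 2 * ∑ k, dD (e k) (dD (e k) (dD v (U i))) p := by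
    intro v i
    rw [dD_sub v (hUs i) (contDiff_const.mul (sL i)), dD_cmul v _ (sL i),
      dD_sum v _ (fun k => hDD _ _ _)]
    funext p
    have hc : ∀ k, dD v (dD (e k) (dD (e k) (U i))) = dD (e k) (dD (e k) (dD v (U i))) := by
      intro k
      rw [dD_comm v _ (hD _ _), dD_comm v _ (hUs _)]
    simp only [hc]
  simp only [hdt (sM _), hpd (sM _), dM] at hE
  have sA : ∀ i, ContDiff ℝ (⊤ : ℕ∞)
      (fun p => dD τ (U i) p + ∑ j, U j p * dD (e j) (U i) p) :=
    fun i => (hD _ _).add (ContDiff.sum fun j _ => (hUs j).mul (hD _ _))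
  have dA : ∀ k i, dD (e k) (dD (e k) (fun p => dD τ (U i) p + ∑ j, U j p * dD (e j) (U i) p))
      = fun p => dD (e k) (dD (e k) (dD τ (U i))) p
        + ∑ j, ((U j p * dD (e k) (dD (e k) (dD (e j) (U i))) p
            + dD (e k) (U j) p * dD (e k) (dD (e j) (U i)) p)
          + (dD (e k) (U j) p * dD (e k) (dD (e j) (U i)) p
            + dD (e k) (dD (e k) (U j)) p * dD (e j) (U i) p)) := by
    intro k i
    rw [dD_add _ (hD _ _) (ContDiff.sum fun j _ => (hUs j).mul (hD _ _)),
      dD_sum _ _ (fun j => (hUs j).mul (hD _ _))]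
    simp only [dD_mul _ (hUs _) (hD _ _)]
    rw [dD_add _ (hDD _ _ _) (ContDiff.sum fun j _ =>
      ((hUs j).mul (hDD _ _ _)).add ((hD _ _).mul (hD _ _))),
      dD_sum _ _ (fun j => ((hUs j).mul (hDD _ _ _)).add ((hD _ _).mul (hD _ _)))]
    simp only [dD_add _ ((hUs _).mul (hDD _ _ _)) ((hD _ _).mul (hD _ _)),
      dD_mul _ (hUs _) (hDD _ _ _), dD_mul _ (hD _ _) (hD _ _)]
  have sP : ∀ i j k l, ContDiff ℝ (⊤ : ℕ∞) (fun p => dD (e j) (U i) p * dD (e l) (U k) p) :=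
    fun i j k l => (hD _ _).mul (hD _ _)
  have sdiv : ContDiff ℝ (⊤ : ℕ∞) (fun p => ∑ j, dD (e j) (U j) p) :=
    ContDiff.sum fun j _ => hD _ _
  have s1 : ∀ k, ContDiff ℝ (⊤ : ℕ∞) (fun p => ∑ j, (dD (e j) (U i) p * dD (e k) (U j) p
      + dD (e j) (U i) p * dD (e j) (U k) p - dD (e i) (U j) p * dD (e k) (U j) p)) :=
    fun k => ContDiff.sum fun j _ => ((sP _ _ _ _).add (sP _ _ _ _)).sub (sP _ _ _ _)
  have s2 : ∀ k, ContDiff ℝ (⊤ : ℕ∞) (fun p => dD (e k) (U i) p * ∑ j, dD (e j) (U j) p) :=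
    fun k => (hD _ _).mul sdiv
  have s3 : ContDiff ℝ (⊤ : ℕ∞) (fun p => ∑ j, ∑ l, dD (e l) (U j) p * dD (e l) (U j) p) :=
    ContDiff.sum fun j _ => ContDiff.sum fun l _ => sP _ _ _ _
  have sR : ∀ k, ContDiff ℝ (⊤ : ℕ∞) (fun p => (∑ j, (dD (e j) (U i) p * dD (e k) (U j) p
      + dD (e j) (U i) p * dD (e j) (U k) p - dD (e i) (U j) p * dD (e k) (U j) p))
      - dD (e k) (U i) p * (∑ j, dD (e j) (U j) p)
      + (1 / 2) * (if i = k then (1 : ℝ) else 0) * ∑ j, ∑ l, dD (e l) (U j) p * dD (e l) (U j) p) :=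
    fun k => ((s1 k).sub (s2 k)).add (contDiff_const.mul s3)
  have sQ : ContDiff ℝ (⊤ : ℕ∞) (fun p => ∑ j, U j p * U j p) :=
    ContDiff.sum fun j _ => (hUs j).mul (hUs j)
  have dR : ∀ k, dD (e k) (fun p => (∑ j, (dD (e j) (U i) p * dD (e k) (U j) p
      + dD (e j) (U i) p * dD (e j) (U k) p - dD (e i) (U j) p * dD (e k) (U j) p))
      - dD (e k) (U i) p * (∑ j, dD (e j) (U j) p)
      + (1 / 2) * (if i = k then (1 : ℝ) else 0) * ∑ j, ∑ l, dD (e l) (U j) p * dD (e l) (U j) p)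
      = fun p => (∑ j, ((dD (e j) (U i) p * dD (e k) (dD (e k) (U j)) p
              + dD (e k) (dD (e j) (U i)) p * dD (e k) (U j) p)
            + (dD (e j) (U i) p * dD (e k) (dD (e j) (U k)) p
              + dD (e k) (dD (e j) (U i)) p * dD (e j) (U k) p)
            - (dD (e i) (U j) p * dD (e k) (dD (e k) (U j)) p
              + dD (e k) (dD (e i) (U j)) p * dD (e k) (U j) p)))
          - (dD (e k) (U i) p * (∑ j, dD (e k) (dD (e j) (U j)) p)
            + dD (e k) (dD (e k) (U i)) p * ∑ j, dD (e j) (U j) p)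
          + (1 / 2) * (if i = k then (1 : ℝ) else 0) * ∑ j, ∑ l,
            (dD (e l) (U j) p * dD (e k) (dD (e l) (U j)) p
              + dD (e k) (dD (e l) (U j)) p * dD (e l) (U j) p) := by
    intro k
    rw [dD_add _ ((s1 k).sub (s2 k)) (contDiff_const.mul s3), dD_sub _ (s1 k) (s2 k),
      dD_cmul _ _ s3, dD_mul _ (hD _ _) sdiv, dD_sum _ _ (fun j => hD _ _),
      dD_sum _ _ (fun j => ((sP _ _ _ _).add (sP _ _ _ _)).sub (sP _ _ _ _)),
      dD_sum _ _ (fun j => ContDiff.sum fun l _ => sP _ _ _ _)]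
    simp only [dD_sum _ _ (fun l => sP _ l _ l), dD_sub _ ((sP _ _ _ _).add (sP _ _ _ _)) (sP _ _ _ _),
      dD_add _ (sP _ _ _ _) (sP _ _ _ _), dD_mul _ (hD _ _) (hD _ _)]
  simp only [pow_two (dD _ _ _), pow_two (U _ _)]
  rw [hpd sQ, dD_sum _ _ (fun j => (hUs j).mul (hUs j)), hlap (sA i)]
  simp only [hpd (sR _), dR, dA, dD_mul _ (hUs _) (hUs _)]
  exact epdiff_alg α (fun j => U j (t, x)) (fun i j => dD (e j) (U i) (t, x))
    (fun i j k => dD (e k) (dD (e j) (U i)) (t, x))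
    (fun i j k => dD (e k) (dD (e k) (dD (e j) (U i))) (t, x))
    (fun i j k => by rw [dD_comm _ _ (hUs _)]) i _ _ hE
end

section
/- Fix integers n, N ≥ 1 and let f, g: ℝⁿ → ℝⁿ be smooth vector fields. On the phase space (ℝⁿ × ℝⁿ)^N with its canonical Poisson bracket, the momentum functions J_f(Q,P) = Σ_{a=1}^N P^a · f(Q^a) and J_g(Q,P) = Σ_{a=1}^N P^a · g(Q^a) satisfy {J_f, J_g}(Q,P) = Σ_{a=1}^N Σ_i P^a_i ( Σ_k g_k(Q^a) ∂_k f_i(Q^a) − Σ_k f_k(Q^a) ∂_k g_i(Q^a) ) = J_{(g·∇)f − (f·∇)g}(Q,P). That is, the singular (peakon) solution ansatz m = Σ_a P^a δ(· − Q^a) defines a Poisson map from the canonical phase space to the dual of the Lie algebra of vector fields with its Lie–Poisson bracket: the bracket of two momentum pairings is the momentum pairing with (minus) the Jacobi–Lie bracket of the vector fields. -/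
/-- Canonical Poisson bracket on the phase space (ℝⁿ × ℝⁿ)^N of N point configurations:
{F,H} = Σₐ Σₖ (∂F/∂Qᵃₖ ∂H/∂Pᵃₖ − ∂F/∂Pᵃₖ ∂H/∂Qᵃₖ). -/
noncomputable def pbracket {n N : ℕ}
    (F H : (Fin N → Fin n → ℝ) × (Fin N → Fin n → ℝ) → ℝ)
    (z : (Fin N → Fin n → ℝ) × (Fin N → Fin n → ℝ)) : ℝ :=
  ∑ a, ∑ k,
    (fderiv ℝ F z (Pi.single a (Pi.single k 1), 0)
        * fderiv ℝ H z (0, Pi.single a (Pi.single k 1))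
      - fderiv ℝ F z (0, Pi.single a (Pi.single k 1))
        * fderiv ℝ H z (Pi.single a (Pi.single k 1), 0))

theorem fderiv_J_aux {n N : ℕ} (f : (Fin n → ℝ) → Fin n → ℝ) (hf : ContDiff ℝ (⊤ : ℕ∞) f)
    (z v : (Fin N → Fin n → ℝ) × (Fin N → Fin n → ℝ)) :
    fderiv ℝ (fun z : (Fin N → Fin n → ℝ) × (Fin N → Fin n → ℝ) =>
        ∑ a, ∑ i, z.2 a i * f (z.1 a) i) z v
      = ∑ a, ∑ i, (z.2 a i * fderiv ℝ (fun x => f x i) (z.1 a) (v.1 a)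
          + f (z.1 a) i * v.2 a i) := by
  have hd : Differentiable ℝ f := hf.differentiable (by simp)
  have key : ∀ a : Fin N, ∀ i : Fin n, HasFDerivAt
      (fun z : (Fin N → Fin n → ℝ) × (Fin N → Fin n → ℝ) => z.2 a i * f (z.1 a) i)
      (z.2 a i • ((fderiv ℝ (fun x => f x i) (z.1 a)).comp
          ((ContinuousLinearMap.proj (R := ℝ) (φ := fun _ : Fin N => Fin n → ℝ) a).comp
            (ContinuousLinearMap.fst ℝ (Fin N → Fin n → ℝ) (Fin N → Fin n → ℝ))))
        + f (z.1 a) i • ((ContinuousLinearMap.proj (R := ℝ) (φ := fun _ : Fin n => ℝ) i).comp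
          ((ContinuousLinearMap.proj (R := ℝ) (φ := fun _ : Fin N => Fin n → ℝ) a).comp
            (ContinuousLinearMap.snd ℝ (Fin N → Fin n → ℝ) (Fin N → Fin n → ℝ))))) z := by
    intro a i
    have h1 : DifferentiableAt ℝ (fun x => f x i) (z.1 a) :=
      (differentiable_pi.1 hd i) (z.1 a)
    have h2 := ((ContinuousLinearMap.proj (R := ℝ) (φ := fun _ : Fin N => Fin n → ℝ) a).comp
            (ContinuousLinearMap.fst ℝ (Fin N → Fin n → ℝ) (Fin N → Fin n → ℝ))).hasFDerivAt (x := z)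
    have h3 := ((ContinuousLinearMap.proj (R := ℝ) (φ := fun _ : Fin n => ℝ) i).comp
          ((ContinuousLinearMap.proj (R := ℝ) (φ := fun _ : Fin N => Fin n → ℝ) a).comp
            (ContinuousLinearMap.snd ℝ (Fin N → Fin n → ℝ) (Fin N → Fin n → ℝ)))).hasFDerivAt
              (x := z)
    exact h3.mul (HasFDerivAt.comp z (g := fun x => f x i) h1.hasFDerivAt h2)
  have hs := HasFDerivAt.fun_sum (u := Finset.univ) (fun a _ =>
    HasFDerivAt.fun_sum (u := Finset.univ) (fun i _ => key a i))
  rw [hs.fderiv]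
  simp [ContinuousLinearMap.sum_apply]

theorem fderiv_J_P {n N : ℕ} (f : (Fin n → ℝ) → Fin n → ℝ) (hf : ContDiff ℝ (⊤ : ℕ∞) f)
    (z : (Fin N → Fin n → ℝ) × (Fin N → Fin n → ℝ)) (a : Fin N) (k : Fin n) :
    fderiv ℝ (fun z : (Fin N → Fin n → ℝ) × (Fin N → Fin n → ℝ) =>
        ∑ a, ∑ i, z.2 a i * f (z.1 a) i) z (0, Pi.single a (Pi.single k 1))
      = f (z.1 a) k := by
  rw [fderiv_J_aux f hf, Finset.sum_eq_single a]
  · simp [Pi.single_apply]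
  · intro b _ hb
    simp [Pi.single_eq_of_ne hb]
  · simp

theorem fderiv_J_Q {n N : ℕ} (f : (Fin n → ℝ) → Fin n → ℝ) (hf : ContDiff ℝ (⊤ : ℕ∞) f)
    (z : (Fin N → Fin n → ℝ) × (Fin N → Fin n → ℝ)) (a : Fin N) (k : Fin n) :
    fderiv ℝ (fun z : (Fin N → Fin n → ℝ) × (Fin N → Fin n → ℝ) =>
        ∑ a, ∑ i, z.2 a i * f (z.1 a) i) z (Pi.single a (Pi.single k 1), 0)
      = ∑ i, z.2 a i * pd (fun x => f x i) k (z.1 a) := by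
  rw [fderiv_J_aux f hf, Finset.sum_eq_single a]
  · simp [pd]
  · intro b _ hb
    simp [Pi.single_eq_of_ne hb]
  · simp

/-- for smooth vector fields f, g the momentum functions
J_f(Q,P) = Σₐ Pᵃ·f(Qᵃ) satisfy {J_f, J_g} = J_{(g·∇)f − (f·∇)g}: the singular solution
momentum map is Poisson into the Lie–Poisson bracket. -/
theorem singular_momentum_map_is_poisson (n N : ℕ) (hn : 1 ≤ n) (hN : 1 ≤ N)
    (f g : (Fin n → ℝ) → Fin n → ℝ) (hf : ContDiff ℝ (⊤ : ℕ∞) f) (hg : ContDiff ℝ (⊤ : ℕ∞) g)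
    (z : (Fin N → Fin n → ℝ) × (Fin N → Fin n → ℝ)) :
    pbracket (fun z => ∑ a, ∑ i, z.2 a i * f (z.1 a) i)
        (fun z => ∑ a, ∑ i, z.2 a i * g (z.1 a) i) z
      = ∑ a, ∑ i, z.2 a i *
          (∑ k, g (z.1 a) k * pd (fun x => f x i) k (z.1 a)
            - ∑ k, f (z.1 a) k * pd (fun x => g x i) k (z.1 a)) := by
  unfold pbracket
  refine Finset.sum_congr rfl fun a _ => ?_
  simp only [fderiv_J_P f hf, fderiv_J_P g hg, fderiv_J_Q f hf, fderiv_J_Q g hg]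
  simp only [mul_sub, Finset.sum_sub_distrib, Finset.mul_sum, Finset.sum_mul]
  congr 1
  · rw [Finset.sum_comm]
    exact Finset.sum_congr rfl fun i _ => Finset.sum_congr rfl fun k _ => by ring
  · rw [Finset.sum_comm]
    exact Finset.sum_congr rfl fun i _ => Finset.sum_congr rfl fun k _ => by ring
end

section
/- Fix integers n, N ≥ 1, let G: ℝⁿ → ℝ be continuously differentiable, and let Q^a, P^a: ℝ → ℝⁿ (a = 1,…,N) be C¹ curves satisfying dQ^a/dt = Σ_{b=1}^N G(Q^a − Q^b) P^b and dP^a_k/dt = −Σ_{b=1}^N (P^a · P^b) ∂_k G(Q^a − Q^b). Define the velocity field u(t,x) = Σ_{b=1}^N G(x − Q^b(t)) P^b(t). Then for every smooth vector field φ: ℝⁿ → ℝⁿ and every t, d/dt Σ_{a=1}^N P^a(t) · φ(Q^a(t)) = Σ_{a=1}^N Σ_{i,j} ( P^a_i(t) u_j(t,Q^a(t)) ∂_j φ_i(Q^a(t)) − P^a_j(t) ∂_i u_j(t,Q^a(t)) φ_i(Q^a(t)) ). That is, the measure-valued momentum ansatz m(·,t) = Σ_a P^a(t) δ(· − Q^a(t))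 with u = G*m satisfies the EPDiff equation ∂_t m_i + ∂_j(u_j m_i) + m_j ∂_i u_j = 0 in the sense of distributions, so the singular solution ansatz provides weak solutions of EPDiff for all N. -/
theorem fderiv_eq_sum_pd {n : ℕ} (f : (Fin n → ℝ) → ℝ) (x v : Fin n → ℝ) :
    fderiv ℝ f x v = ∑ j, v j * pd f j x := by
  conv_lhs => rw [← Finset.univ_sum_single v]
  rw [map_sum]
  refine Finset.sum_congr rfl fun j _ => ?_
  have : (Pi.single j (v j) : Fin n → ℝ) = v j • Pi.single j 1 := by
    rw [← Pi.single_smul]; simp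
  rw [this, map_smul, smul_eq_mul, pd]

/-- the measure-valued ansatz m(·,t) = Σₐ Pᵃ(t)δ(·−Qᵃ(t)) with u = G*m,
where (Q,P) satisfy the N-point evolution equations, is a weak solution of EPDiff:
paired against any smooth test vector field φ,
d/dt ⟨m,φ⟩ = Σₐ Σᵢⱼ ( Pᵃᵢ uⱼ(Qᵃ) ∂ⱼφᵢ(Qᵃ) − Pᵃⱼ ∂ᵢuⱼ(Qᵃ) φᵢ(Qᵃ) ). -/
theorem singular_ansatz_weak_solution (n N : ℕ) (hn : 1 ≤ n) (hN : 1 ≤ N)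
    (G : (Fin n → ℝ) → ℝ) (hG : ContDiff ℝ 1 G)
    (Q P : ℝ → Fin N → Fin n → ℝ) (hQ : ContDiff ℝ 1 Q) (hP : ContDiff ℝ 1 P)
    (hQeq : ∀ (t : ℝ) (a : Fin N) (k : Fin n),
      deriv (fun s => Q s a k) t = ∑ b, G (Q t a - Q t b) * P t b k)
    (hPeq : ∀ (t : ℝ) (a : Fin N) (k : Fin n),
      deriv (fun s => P s a k) t
        = -∑ b, (∑ i, P t a i * P t b i) * pd G k (Q t a - Q t b))
    (u : ℝ → (Fin n → ℝ) → Fin n → ℝ)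
    (hu : ∀ t x i, u t x i = ∑ b, G (x - Q t b) * P t b i)
    (φ : (Fin n → ℝ) → Fin n → ℝ) (hφ : ContDiff ℝ (⊤ : ℕ∞) φ) (t : ℝ) :
    deriv (fun s => ∑ a, ∑ i, P s a i * φ (Q s a) i) t
      = ∑ a, ∑ i, ∑ j,
          (P t a i * u t (Q t a) j * pd (fun x => φ x i) j (Q t a)
            - P t a j * pd (fun x => u t x j) i (Q t a) * φ (Q t a) i) := by
  have hQd : ∀ a, HasDerivAt (fun s => Q s a) (fun k => u t (Q t a) k) t := by
    intro a
    rw [hasDerivAt_pi]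
    intro k
    have hd : DifferentiableAt ℝ (fun s => Q s a k) t := by
      have h1 : DifferentiableAt ℝ Q t := (hQ.differentiable (by norm_num)) t
      exact differentiableAt_pi.1 (differentiableAt_pi.1 h1 a) k
    have h := hd.hasDerivAt
    rw [hQeq] at h
    rw [hu]
    exact h
  have hPd : ∀ a k, HasDerivAt (fun s => P s a k)
      (-∑ b, (∑ i, P t a i * P t b i) * pd G k (Q t a - Q t b)) t := by
    intro a k
    have hd : DifferentiableAt ℝ (fun s => P s a k) t := by
      have h1 : DifferentiableAt ℝ P t := (hP.differentiable (by norm_num)) t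
      exact differentiableAt_pi.1 (differentiableAt_pi.1 h1 a) k
    have h := hd.hasDerivAt
    rw [hPeq] at h
    exact h
  have hφd : ∀ x i, DifferentiableAt ℝ (fun x => φ x i) x := by
    intro x i
    have h1 : DifferentiableAt ℝ φ x := (hφ.differentiable (by simp)) x
    exact differentiableAt_pi.1 h1 i
  have hpu : ∀ x i j, pd (fun x => u t x j) i x = ∑ b, pd G i (x - Q t b) * P t b j := by
    intro x i j
    have hE : (fun x => u t x j) = fun x => ∑ b, G (x - Q t b) * P t b j := by
      funext x; exact hu t x j
    have hd : HasFDerivAt (fun x => ∑ b, G (x - Q t b) * P t b j)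
        (∑ b, P t b j • fderiv ℝ G (x - Q t b)) x := by
      refine HasFDerivAt.fun_sum fun b _ => ?_
      have hg : HasFDerivAt G (fderiv ℝ G (x - Q t b)) (x - Q t b) :=
        ((hG.differentiable (by norm_num)) _).hasFDerivAt
      have := hg.comp x ((hasFDerivAt_id x).sub_const (Q t b))
      exact this.mul_const (P t b j)
    rw [pd, hE, hd.fderiv, ContinuousLinearMap.sum_apply]
    refine Finset.sum_congr rfl fun b _ => ?_
    simp [pd, mul_comm]
  have key : HasDerivAt (fun s => ∑ a, ∑ i, P s a i * φ (Q s a) i)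
      (∑ a, ∑ i, ((-∑ b, (∑ k, P t a k * P t b k) * pd G i (Q t a - Q t b)) * φ (Q t a) i
        + P t a i * fderiv ℝ (fun x => φ x i) (Q t a) (fun k => u t (Q t a) k))) t := by
    refine HasDerivAt.fun_sum fun a _ => HasDerivAt.fun_sum fun i _ => ?_
    have h2 := (hφd (Q t a) i).hasFDerivAt.comp_hasDerivAt t (hQd a)
    exact (hPd a i).mul h2
  rw [key.deriv]
  refine Finset.sum_congr rfl fun a _ => Finset.sum_congr rfl fun i _ => ?_
  rw [fderiv_eq_sum_pd, Finset.sum_sub_distrib, ← Finset.sum_mul, Finset.mul_sum]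
  have h1 : ∑ b, (∑ k, P t a k * P t b k) * pd G i (Q t a - Q t b)
      = ∑ j, P t a j * pd (fun x => u t x j) i (Q t a) := by
    simp only [hpu, Finset.mul_sum, Finset.sum_mul]
    rw [Finset.sum_comm]
    refine Finset.sum_congr rfl fun j _ => Finset.sum_congr rfl fun b _ => ?_
    ring
  rw [h1]
  simp only [mul_assoc]
  ring
end
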